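/- Let A be a unital commutative k-algebra. Then the triple (Ш(A), ⧢, 1_k), where Ш(A) = ⊕_{n≥0} A^{⊗n} is equipped with the λ-TD shuffle product ⧢ and unit 1 ∈ k = A^{⊗0}, is a unital commutative k-algebra. -/

import Mathlib

/-!
Common setup: the `λ`-TD shuffle product on `Ш(A) = ⊕_{n ≥ 0} A^{⊗n}` over a commutative
ring `k`, where `A` is a unital commutative `k`-algebra and `A^{⊗0} = k`.  Pure tensors of
positive length are written `Fin.cons a f`, the operation "prepend `a`", i.e. `a ⊗ (–)`,
is implemented as multiplication by the degree-one element `shIota k A a` in the graded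
(concatenation) algebra `⊕_{n ≥ 0} A^{⊗n}`.
-/

open scoped TensorProduct DirectSum
open PiTensorProduct

noncomputable section

variable (k A : Type*) [CommRing k] [CommRing A] [Algebra k A]

/-- The shuffle module `Ш(A) = ⊕_{n ≥ 0} A^{⊗n}` (with `A^{⊗0} = k`). -/
abbrev ShuffleModule : Type _ := ⨁ n : ℕ, ⨂[k]^n A

/-- The pure tensor `a₁ ⊗ ⋯ ⊗ aₙ ∈ A^{⊗n} ⊆ Ш(A)`. -/
def shEmb {n : ℕ} (f : Fin n → A) : ShuffleModule k A :=
  DirectSum.lof k ℕ (fun n => ⨂[k]^n A) n (tprod k f)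

/-- The inclusion of `A^{⊗0} = k` into `Ш(A)`. -/
def shDeg0 (v : ⨂[k]^0 A) : ShuffleModule k A :=
  DirectSum.lof k ℕ (fun n => ⨂[k]^n A) 0 v

/-- Length-one pure tensors, as a linear map `A →ₗ[k] Ш(A)`. -/
def shIota : A →ₗ[k] ShuffleModule k A :=
  (DirectSum.lof k ℕ (fun n => ⨂[k]^n A) 1).comp
    ((MultilinearMap.ofSubsingleton k A (⨂[k]^1 A) (0 : Fin 1)).symm (tprod k))

/-- The element `1_A ∈ A ⊆ Ш(A)`. -/
def shOneA : ShuffleModule k A := shIota k A (1 : A)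

variable (lam : k)

/-- `sh` is the `λ`-TD shuffle product on `Ш(A) = ⊕_{n≥0} A^{⊗n}`: it is `k`-bilinear, acts
by scalar multiplication when one of the arguments lies in `A^{⊗0} = k`, and for pure tensors
`𝔞 = a₁ ⊗ 𝔞'`, `𝔟 = b₁ ⊗ 𝔟'` of positive lengths it satisfies the recursion
`𝔞 ⧢ 𝔟 = a₁ ⊗ (𝔞' ⧢ 𝔟) + b₁ ⊗ (𝔞 ⧢ 𝔟') + λ·a₁b₁ ⊗ (𝔞' ⧢ 𝔟') − a₁b₁ ⊗ ((𝔞' ⧢ 1_A) ⧢ 𝔟')`. -/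
structure IsLambdaTDShuffle
    (sh : ShuffleModule k A →ₗ[k] ShuffleModule k A →ₗ[k] ShuffleModule k A) : Prop where
  scalar_left : ∀ (v : ⨂[k]^0 A) (x : ShuffleModule k A),
    sh (shDeg0 k A v) x = (isEmptyEquiv (Fin 0) v) • x
  scalar_right : ∀ (v : ⨂[k]^0 A) (x : ShuffleModule k A),
    sh x (shDeg0 k A v) = (isEmptyEquiv (Fin 0) v) • x
  shuffle_rec : ∀ {m n : ℕ} (a b : A) (f : Fin m → A) (g : Fin n → A),
    sh (shEmb k A (Fin.cons a f)) (shEmb k A (Fin.cons b g)) =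
      shIota k A a * sh (shEmb k A f) (shEmb k A (Fin.cons b g))
      + shIota k A b * sh (shEmb k A (Fin.cons a f)) (shEmb k A g)
      + lam • (shIota k A (a * b) * sh (shEmb k A f) (shEmb k A g))
      - shIota k A (a * b) * sh (sh (shEmb k A f) (shOneA k A)) (shEmb k A g)

end

noncomputable section
variable {k A : Type*} [CommRing k] [CommRing A] [Algebra k A] {lam : k}

/-- A bilinear product `sh` with two-sided unit `u` which obeys the `λ`-TD shuffle recursion with
respect to a prepending operation `c`. -/
structure IsTDRecursive {M : Type*} [AddCommGroup M] [Module k M] (lam : k)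
    (c : A →ₗ[k] M →ₗ[k] M) (u : M) (sh : M →ₗ[k] M →ₗ[k] M) : Prop where
  unit_left : ∀ x, sh u x = x
  unit_right : ∀ x, sh x u = x
  cons_cons : ∀ (a b : A) (x y : M), sh (c a x) (c b y) =
    c a (sh x (c b y)) + c b (sh (c a x) y) + lam • c (a * b) (sh x y)
      - c (a * b) (sh (sh x (c 1 u)) y)

/-- The elements obtained from `u` by prepending at most `n` letters. -/
inductive IsWord {M : Type*} [AddCommGroup M] [Module k M]
    (c : A →ₗ[k] M →ₗ[k] M) (u : M) : ℕ → M → Prop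
  | unit (n : ℕ) : IsWord c u n u
  | cons {n : ℕ} (a : A) {x : M} : IsWord c u n x → IsWord c u (n + 1) (c a x)

/-- The span of the words of length at most `n`. -/
def wordSpan {M : Type*} [AddCommGroup M] [Module k M]
    (c : A →ₗ[k] M →ₗ[k] M) (u : M) (n : ℕ) : Submodule k M :=
  Submodule.span k {x | IsWord c u n x}

section Recursive

variable {M : Type*} [AddCommGroup M] [Module k M] {c : A →ₗ[k] M →ₗ[k] M} {u : M}
  {sh : M →ₗ[k] M →ₗ[k] M}

theorem IsWord.mono {m n : ℕ} {x : M} (hx : IsWord c u m x) (hmn : m ≤ n) : IsWord c u n x := by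
  induction hx generalizing n with
  | unit => exact .unit n
  | cons a _ ih =>
    obtain ⟨n, rfl⟩ := Nat.exists_eq_add_of_le' (Nat.le_of_add_left_le hmn)
    exact .cons a (ih (by omega))

theorem wordSpan_mono : Monotone (wordSpan c u) := fun _ _ h =>
  Submodule.span_mono fun _ hx => IsWord.mono hx h

theorem IsWord.mem_wordSpan {n : ℕ} {x : M} (hx : IsWord c u n x) : x ∈ wordSpan c u n :=
  Submodule.subset_span hx

theorem cons_mem_wordSpan {n : ℕ} (a : A) {x : M} (hx : x ∈ wordSpan c u n) :
    c a x ∈ wordSpan c u (n + 1) := by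
  induction hx using Submodule.span_induction with
  | mem x hx => exact (IsWord.cons a hx).mem_wordSpan
  | zero => simp
  | add x y _ _ hx hy => simpa using add_mem hx hy
  | smul r x _ hx => simpa using Submodule.smul_mem _ r hx

theorem sh_mem_of_isWord {p q : ℕ} {W : Submodule k M}
    (h : ∀ x y, IsWord c u p x → IsWord c u q y → sh x y ∈ W)
    {x y : M} (hx : x ∈ wordSpan c u p) (hy : y ∈ wordSpan c u q) : sh x y ∈ W := by
  have hx' : wordSpan c u p ≤ W.comap (sh.flip y) := Submodule.span_le.2 fun x hx => by
    have hy' : wordSpan c u q ≤ W.comap (sh x) := Submodule.span_le.2 fun y hy => h x y hx hy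
    exact hy' hy
  exact hx' hx

theorem sh_comm_of_isWord {p q : ℕ}
    (h : ∀ x y, IsWord c u p x → IsWord c u q y → sh x y = sh y x)
    {x y : M} (hx : x ∈ wordSpan c u p) (hy : y ∈ wordSpan c u q) : sh x y = sh y x := by
  induction hx, hy using Submodule.span_induction₂ with
  | mem_mem x y hx hy => exact h x y hx hy
  | _ => simp_all

theorem sh_assoc_of_isWord {p q r : ℕ}
    (h : ∀ x y z, IsWord c u p x → IsWord c u q y → IsWord c u r z →
      sh (sh x y) z = sh x (sh y z))
    {x y z : M} (hx : x ∈ wordSpan c u p) (hy : y ∈ wordSpan c u q) (hz : z ∈ wordSpan c u r) :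
    sh (sh x y) z = sh x (sh y z) := by
  induction hz using Submodule.span_induction with
  | mem z hz =>
    induction hx, hy using Submodule.span_induction₂ with
    | mem_mem x y hx hy => exact h x y z hx hy hz
    | _ => simp_all
  | _ => simp_all

namespace IsTDRecursive

variable {lam : k}

theorem sh_mem (H : IsTDRecursive lam c u sh) {p q : ℕ} {x y : M}
    (hx : x ∈ wordSpan c u p) (hy : y ∈ wordSpan c u q) :
    sh x y ∈ wordSpan c u (p + q) := by
  induction hN : p + q using Nat.strong_induction_on generalizing p q x y with
  | _ N ih =>
  subst hN
  refine sh_mem_of_isWord ?_ hx hy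
  clear hx hy x y
  intro x y hx hy
  rcases hx with _ | @⟨p, a, x, hx⟩
  · rw [H.unit_left]
    exact (hy.mono (by omega)).mem_wordSpan
  rcases hy with _ | @⟨q, b, y, hy⟩
  · rw [H.unit_right]
    exact ((hx.cons a).mono (by omega)).mem_wordSpan
  have mem {m n : ℕ} {v w : M} (hv : v ∈ wordSpan c u m) (hw : w ∈ wordSpan c u n)
      (hmn : m + n < p + 1 + (q + 1)) : sh v w ∈ wordSpan c u (m + n) := ih _ hmn hv hw rfl
  have pre {n : ℕ} (d : A) {w : M} (hw : w ∈ wordSpan c u n) (hn : n ≤ p + q + 1) :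
      c d w ∈ wordSpan c u (p + 1 + (q + 1)) :=
    wordSpan_mono (by omega) (cons_mem_wordSpan d hw)
  rw [H.cons_cons]
  have hxe := mem hx.mem_wordSpan (IsWord.cons 1 (.unit 0)).mem_wordSpan (by omega)
  exact sub_mem (add_mem (add_mem
    (pre a (mem hx.mem_wordSpan (hy.cons b).mem_wordSpan (by omega)) (by omega))
    (pre b (mem (hx.cons a).mem_wordSpan hy.mem_wordSpan (by omega)) (by omega)))
    (Submodule.smul_mem _ lam
      (pre (a * b) (mem hx.mem_wordSpan hy.mem_wordSpan (by omega)) (by omega))))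
    (pre (a * b) (mem hxe hy.mem_wordSpan (by omega)) (by omega))

theorem sh_cons_cons_sh_cons (H : IsTDRecursive lam c u sh) (a b d : A) (x y z : M) :
    sh (sh (c a x) (c b y)) (c d z) =
      c a (sh (sh x (c b y)) (c d z)) + c b (sh (sh (c a x) y) (c d z))
      + c d (sh (sh (c a x) (c b y)) z)
      + lam • c (a * d) (sh (sh x (c b y)) z) + lam • c (b * d) (sh (sh (c a x) y) z)
      + lam • c (a * b) (sh (sh x y) (c d z))
      - c (a * d) (sh (sh (sh x (c b y)) (c 1 u)) z)
      - c (b * d) (sh (sh (sh (c a x) y) (c 1 u)) z)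
      - c (a * b) (sh (sh (sh x (c 1 u)) y) (c d z))
      + (lam * lam) • c (a * (b * d)) (sh (sh x y) z)
      - lam • c (a * (b * d)) (sh (sh (sh x y) (c 1 u)) z)
      - lam • c (a * (b * d)) (sh (sh (sh x (c 1 u)) y) z)
      + c (a * (b * d)) (sh (sh (sh (sh x (c 1 u)) y) (c 1 u)) z) := by
  rw [H.cons_cons a b x y]
  simp only [map_add, map_sub, map_smul, LinearMap.add_apply, LinearMap.sub_apply,
    LinearMap.smul_apply, H.cons_cons, mul_assoc]
  module

theorem sh_cons_sh_cons_cons (H : IsTDRecursive lam c u sh) (a b d : A) (x y z : M) :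
    sh (c a x) (sh (c b y) (c d z)) =
      c a (sh x (sh (c b y) (c d z))) + c b (sh (c a x) (sh y (c d z)))
      + c d (sh (c a x) (sh (c b y) z))
      + lam • c (a * d) (sh x (sh (c b y) z)) + lam • c (b * d) (sh (c a x) (sh y z))
      + lam • c (a * b) (sh x (sh y (c d z)))
      - c (a * d) (sh (sh x (c 1 u)) (sh (c b y) z))
      - c (b * d) (sh (c a x) (sh (sh y (c 1 u)) z))
      - c (a * b) (sh (sh x (c 1 u)) (sh y (c d z)))
      + (lam * lam) • c (a * (b * d)) (sh x (sh y z))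
      - lam • c (a * (b * d)) (sh x (sh (sh y (c 1 u)) z))
      - lam • c (a * (b * d)) (sh (sh x (c 1 u)) (sh y z))
      + c (a * (b * d)) (sh (sh x (c 1 u)) (sh (sh y (c 1 u)) z)) := by
  rw [H.cons_cons b d y z]
  simp only [map_add, map_sub, map_smul, H.cons_cons]
  module

theorem comm_and_assoc (H : IsTDRecursive lam c u sh) (N : ℕ) :
    (∀ p q : ℕ, p + q = N → ∀ x ∈ wordSpan c u p, ∀ y ∈ wordSpan c u q, sh x y = sh y x) ∧
    (∀ p q r : ℕ, p + q + r = N → ∀ x ∈ wordSpan c u p, ∀ y ∈ wordSpan c u q,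
      ∀ z ∈ wordSpan c u r, sh (sh x y) z = sh x (sh y z)) := by
  induction N using Nat.strong_induction_on with
  | _ N ih =>
  have comm {p q : ℕ} {x y : M} (hN : p + q < N) (hx : x ∈ wordSpan c u p)
      (hy : y ∈ wordSpan c u q) : sh x y = sh y x := (ih _ hN).1 p q rfl x hx y hy
  have assoc {p q r : ℕ} {x y z : M} (hN : p + q + r < N) (hx : x ∈ wordSpan c u p)
      (hy : y ∈ wordSpan c u q) (hz : z ∈ wordSpan c u r) :
      sh (sh x y) z = sh x (sh y z) := (ih _ hN).2 p q r rfl x hx y hy z hz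
  have he : c 1 u ∈ wordSpan c u 1 := (IsWord.cons 1 (.unit 0)).mem_wordSpan
  constructor
  · intro p q hN x hx y hy
    refine sh_comm_of_isWord ?_ hx hy
    clear hx hy x y
    intro x y hx hy
    rcases hx with _ | @⟨p, a, x, hx⟩
    · rw [H.unit_left, H.unit_right]
    rcases hy with _ | @⟨q, b, y, hy⟩
    · rw [H.unit_left, H.unit_right]
    have hX := (hx.cons a).mem_wordSpan
    have hY := (hy.cons b).mem_wordSpan
    replace hx := hx.mem_wordSpan
    replace hy := hy.mem_wordSpan
    have hxey : sh (sh x (c 1 u)) y = sh (sh y (c 1 u)) x := by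
      rw [assoc (by omega) hx he hy, comm (by omega) he hy,
        comm (by omega) hx (H.sh_mem hy he)]
    rw [H.cons_cons, H.cons_cons, mul_comm b a, hxey, comm (by omega) hx hy,
      comm (by omega) hx hY, comm (by omega) hX hy]
    abel
  · intro p q r hN x hx y hy z hz
    refine sh_assoc_of_isWord ?_ hx hy hz
    clear hx hy hz x y z
    intro x y z hx hy hz
    rcases hx with _ | @⟨p, a, x, hx⟩
    · rw [H.unit_left, H.unit_left]
    rcases hy with _ | @⟨q, b, y, hy⟩
    · rw [H.unit_left, H.unit_right]
    rcases hz with _ | @⟨r, d, z, hz⟩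
    · rw [H.unit_right, H.unit_right]
    have hX := (hx.cons a).mem_wordSpan
    have hY := (hy.cons b).mem_wordSpan
    have hZ := (hz.cons d).mem_wordSpan
    replace hx := hx.mem_wordSpan
    replace hy := hy.mem_wordSpan
    replace hz := hz.mem_wordSpan
    have hxe := H.sh_mem hx he
    have hye := H.sh_mem hy he
    have hxYe : sh (sh x (c b y)) (c 1 u) = sh (sh x (c 1 u)) (c b y) := by
      rw [assoc (by omega) hx hY he, comm (by omega) hY he, assoc (by omega) hx he hY]
    rw [H.sh_cons_cons_sh_cons, H.sh_cons_sh_cons_cons, hxYe,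
      assoc (by omega) hX hy he, assoc (by omega) hx hy he, assoc (by omega) hxe hy he,
      assoc (by omega) hx hY hZ, assoc (by omega) hX hy hZ, assoc (by omega) hX hY hz,
      assoc (by omega) hx hY hz, assoc (by omega) hX hy hz, assoc (by omega) hx hy hZ,
      assoc (by omega) hxe hY hz, assoc (by omega) hX hye hz, assoc (by omega) hxe hy hZ,
      assoc (by omega) hx hy hz, assoc (by omega) hx hye hz, assoc (by omega) hxe hy hz,
      assoc (by omega) hxe hye hz]

theorem sh_comm (H : IsTDRecursive lam c u sh) (hM : ∀ x, ∃ n, x ∈ wordSpan c u n) (x y : M) :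
    sh x y = sh y x := by
  obtain ⟨p, hx⟩ := hM x
  obtain ⟨q, hy⟩ := hM y
  exact (H.comm_and_assoc _).1 p q rfl x hx y hy

theorem sh_assoc (H : IsTDRecursive lam c u sh) (hM : ∀ x, ∃ n, x ∈ wordSpan c u n) (x y z : M) :
    sh (sh x y) z = sh x (sh y z) := by
  obtain ⟨p, hx⟩ := hM x
  obtain ⟨q, hy⟩ := hM y
  obtain ⟨r, hz⟩ := hM z
  exact (H.comm_and_assoc _).2 p q r rfl x hx y hy z hz

end IsTDRecursive

end Recursive

variable (k A) in
/-- Prepending a letter to a tensor, as a bilinear map. -/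
def shCons : A →ₗ[k] ShuffleModule k A →ₗ[k] ShuffleModule k A :=
  (LinearMap.mul k (ShuffleModule k A)).comp (shIota k A)

theorem shCons_apply (a : A) (x : ShuffleModule k A) : shCons k A a x = shIota k A a * x := rfl

theorem shEmb_comp_cast {m n : ℕ} (h : m = n) (f : Fin n → A) :
    shEmb k A (f ∘ Fin.cast h) = shEmb k A f := by
  subst h
  rfl

theorem shIota_mul_shEmb {n : ℕ} (a : A) (f : Fin n → A) :
    shIota k A a * shEmb k A f = shEmb k A (Fin.cons a f : Fin (n + 1) → A) := by
  change DirectSum.of (fun n => ⨂[k]^n A) 1 (tprod k fun _ => a) *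
    DirectSum.of (fun n => ⨂[k]^n A) n (tprod k f) = _
  rw [DirectSum.of_mul_of, TensorPower.tprod_mul_tprod, Fin.append_left_eq_cons]
  exact shEmb_comp_cast (Nat.add_comm 1 n) _

theorem shEmb_elim0 (f : Fin 0 → A) :
    shEmb k A f = shDeg0 k A ((isEmptyEquiv (Fin 0)).symm (1 : k)) := by
  rw [shEmb, shDeg0, Subsingleton.elim f isEmptyElim]
  simp [isEmptyEquiv]

theorem isWord_shEmb {n : ℕ} (f : Fin n → A) :
    IsWord (shCons k A) (shDeg0 k A ((isEmptyEquiv (Fin 0)).symm (1 : k))) n (shEmb k A f) := by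
  induction n with
  | zero => exact shEmb_elim0 (k := k) f ▸ .unit 0
  | succ n ih =>
    rw [← Fin.cons_self_tail f, ← shIota_mul_shEmb]
    exact .cons (f 0) (ih (Fin.tail f))

theorem span_range_shEmb :
    Submodule.span k (Set.range fun f : Σ n, Fin n → A => shEmb k A f.2) = ⊤ := by
  refine eq_top_iff.2 fun x _ => ?_
  induction x using DirectSum.induction_on with
  | zero => exact zero_mem _
  | add x y hx hy => exact add_mem (hx trivial) (hy trivial)
  | of n v =>
    have hv : v ∈ Submodule.span k (Set.range (tprod k (s := fun _ : Fin n => A))) :=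
      span_tprod_eq_top (R := k) (s := fun _ : Fin n => A) ▸ Submodule.mem_top
    have hle : Submodule.span k (Set.range (tprod k (s := fun _ : Fin n => A))) ≤
        Submodule.comap (DirectSum.lof k ℕ (fun n => ⨂[k]^n A) n)
          (Submodule.span k (Set.range fun f : Σ n, Fin n → A => shEmb k A f.2)) := by
      rw [Submodule.span_le]
      rintro _ ⟨f, rfl⟩
      exact Submodule.subset_span ⟨⟨n, f⟩, rfl⟩
    exact hle hv

theorem exists_mem_wordSpan (x : ShuffleModule k A) :
    ∃ n, x ∈ wordSpan (shCons k A) (shDeg0 k A ((isEmptyEquiv (Fin 0)).symm (1 : k))) n := by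
  have hx : x ∈ Submodule.span k (Set.range fun f : Σ n, Fin n → A => shEmb k A f.2) :=
    span_range_shEmb (k := k) (A := A) ▸ Submodule.mem_top
  induction hx using Submodule.span_induction with
  | mem x hx =>
    obtain ⟨⟨n, f⟩, rfl⟩ := hx
    exact ⟨n, (isWord_shEmb f).mem_wordSpan⟩
  | zero => exact ⟨0, zero_mem _⟩
  | add x y _ _ hx hy =>
    obtain ⟨m, hx⟩ := hx
    obtain ⟨n, hy⟩ := hy
    exact ⟨max m n, add_mem (wordSpan_mono (le_max_left m n) hx)
      (wordSpan_mono (le_max_right m n) hy)⟩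
  | smul r x _ hx =>
    obtain ⟨n, hx⟩ := hx
    exact ⟨n, Submodule.smul_mem _ r hx⟩

theorem IsLambdaTDShuffle.isTDRecursive
    {sh : ShuffleModule k A →ₗ[k] ShuffleModule k A →ₗ[k] ShuffleModule k A}
    (hsh : IsLambdaTDShuffle k A lam sh) :
    IsTDRecursive lam (shCons k A) (shDeg0 k A ((isEmptyEquiv (Fin 0)).symm (1 : k))) sh where
  unit_left x := by rw [hsh.scalar_left, LinearEquiv.apply_symm_apply, one_smul]
  unit_right x := by rw [hsh.scalar_right, LinearEquiv.apply_symm_apply, one_smul]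
  cons_cons a b x y := by
    have hone : shCons k A 1 (shDeg0 k A ((isEmptyEquiv (Fin 0)).symm (1 : k))) = shOneA k A := by
      rw [← shEmb_elim0 Fin.elim0, shCons_apply, shIota_mul_shEmb]
      change _ = shEmb k A fun _ => 1
      congr 1
      ext i
      exact Fin.cases rfl (fun j => j.elim0) i
    have hx : x ∈ Submodule.span k (Set.range fun f : Σ n, Fin n → A => shEmb k A f.2) :=
      span_range_shEmb (k := k) (A := A) ▸ Submodule.mem_top
    have hy : y ∈ Submodule.span k (Set.range fun f : Σ n, Fin n → A => shEmb k A f.2) :=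
      span_range_shEmb (k := k) (A := A) ▸ Submodule.mem_top
    rw [hone]
    induction hx, hy using Submodule.span_induction₂ with
    | mem_mem x y hx hy =>
      obtain ⟨⟨m, f⟩, rfl⟩ := hx
      obtain ⟨⟨n, g⟩, rfl⟩ := hy
      simpa only [shCons_apply, shIota_mul_shEmb] using hsh.shuffle_rec a b f g
    | zero_left => simp
    | zero_right => simp
    | add_left x y z _ _ _ hx hy =>
      simp only [map_add, LinearMap.add_apply, hx, hy, smul_add]
      abel
    | add_right x y z _ _ _ hx hy =>
      simp only [map_add, hx, hy, smul_add]
      abel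
    | smul_left r x y _ _ h =>
      simp only [map_smul, LinearMap.smul_apply, h]
      module
    | smul_right r x y _ _ h =>
      simp only [map_smul, h]
      module

/-- The triple `(Ш(A), ⧢, 1_k)`, where `Ш(A) = ⊕_{n≥0} A^{⊗n}` carries the
`λ`-TD shuffle product `⧢` and the unit is `1 ∈ k = A^{⊗0}`, is a unital commutative
`k`-algebra: `⧢` is `k`-bilinear (built into `sh`), commutative, associative and unital. -/
theorem lambdaTDShuffle_commRing
    (sh : ShuffleModule k A →ₗ[k] ShuffleModule k A →ₗ[k] ShuffleModule k A)
    (hsh : IsLambdaTDShuffle k A lam sh) :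
    (∀ x y : ShuffleModule k A, sh x y = sh y x) ∧
    (∀ x y z : ShuffleModule k A, sh (sh x y) z = sh x (sh y z)) ∧
    (∀ x : ShuffleModule k A,
      sh (shDeg0 k A ((isEmptyEquiv (Fin 0)).symm (1 : k))) x = x) ∧
    (∀ x : ShuffleModule k A,
      sh x (shDeg0 k A ((isEmptyEquiv (Fin 0)).symm (1 : k))) = x) := by
  have H := hsh.isTDRecursive
  exact ⟨H.sh_comm exists_mem_wordSpan, H.sh_assoc exists_mem_wordSpan, H.unit_left,
    H.unit_right⟩

end
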